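/- arXiv:2006.07600 — 2 statements merged into one kernel-verified Lean document; each statement's English description precedes it below -/
import Mathlib

section
/- Let f, g ∈ ℂ[z] with deg f = m ≥ 1, let C(t) = Σ_{i=1}^m n_i z_i(t) be a zero cycle of f, and consider the deformation f(z) + εg(z) = t with deformed cycle C_ε(t) = Σ_{i=1}^m n_i z_i(t,ε). The displacement function Δ(t,ε) = Σ_{i=1}^m n_i f(z_i(t,ε)) vanishes identically (for all regular values t and all ε small enough) if and only if f, g and C satisfy the composition condition. -/
/-!
STATEMENT 0 (Theorem A, main result).

Setup: `f, g ∈ ℂ[z]`, `deg f = m ≥ 1`.  A zero cycle of `f` is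
`C(t) = ∑ i, a i • z i (t)` where the `z i t` are the `m` (distinct) roots of `f = t`
and `∑ i, a i = 0`.  The multivalued root branches of the deformation
`f + ε g = t` are modelled by continuous functions `z i t ε` defined on a
polydisc `ball t₀ δ ×ˢ ball 0 r` around a regular value `t₀` of `f` (so that
`z i t 0` are the roots of `f = t`), pairwise distinct and satisfying
`(f + ε g)(z i t ε) = t`.

Conclusion: the displacement function `Δ(t,ε) = ∑ i, a i * f (z i t ε)`
vanishes identically (for all regular `t` and all `ε` small, i.e. on the
polydisc) iff `f`, `g` and the cycle satisfy the composition condition: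
`f = f̃ ∘ h`, `g = g̃ ∘ h` and for every `ε` the cycle projected by `h`
is trivial, i.e. `∑_{j : h(z j) = h(z i)} a j = 0` for every `i`.
-/

open Polynomial Metric Finset

open IntermediateField in
/-- A combination of conjugate elements with weights of total sum zero which lies in the ground
field vanishes. -/
theorem eq_zero_of_sum_conjugates {K Ω ι : Type*} [Field K] [CharZero K] [Field Ω] [Algebra K Ω]
    [Fintype ι] (a : ι → ℤ) (ha : ∑ i, a i = 0) (y : ι → Ω) (hy : ∀ i, IsIntegral K (y i))
    (hconj : ∀ i j, minpoly K (y i) = minpoly K (y j)) (c : K)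
    (hc : ∑ i, (a i : Ω) * y i = algebraMap K Ω c) : c = 0 := by
  have : FiniteDimensional K (adjoin K (Set.range y)) :=
    finiteDimensional_adjoin (by rintro _ ⟨i, rfl⟩; exact hy i)
  let w : ι → adjoin K (Set.range y) := fun i => ⟨y i, subset_adjoin _ _ ⟨i, rfl⟩⟩
  have hmin : ∀ i, minpoly K (w i) = minpoly K (y i) := fun i =>
    (minpoly.algebraMap_eq (algebraMap (adjoin K (Set.range y)) Ω).injective (w i)).symm
  have htr : ∀ i j, Algebra.trace K (adjoin K (Set.range y)) (w i) =
      Algebra.trace K (adjoin K (Set.range y)) (w j) := by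
    intro i j
    have hm : minpoly K (w i) = minpoly K (w j) := by rw [hmin, hmin, hconj i j]
    have hfr : Module.finrank K⟮w i⟯ (adjoin K (Set.range y)) =
        Module.finrank K⟮w j⟯ (adjoin K (Set.range y)) := by
      have h1 := Module.finrank_mul_finrank K K⟮w i⟯ (adjoin K (Set.range y))
      have h2 := Module.finrank_mul_finrank K K⟮w j⟯ (adjoin K (Set.range y))
      rw [adjoin.finrank (.of_finite K _)] at h1 h2
      rw [← h2, hm] at h1
      exact Nat.eq_of_mul_eq_mul_left (minpoly.natDegree_pos (.of_finite K _)) h1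
    rw [trace_eq_finrank_mul_minpoly_nextCoeff, trace_eq_finrank_mul_minpoly_nextCoeff, hm, hfr]
  have hsum : ∑ i, a i • w i = algebraMap K (adjoin K (Set.range y)) c := by
    apply (algebraMap (adjoin K (Set.range y)) Ω).injective
    rw [← IsScalarTower.algebraMap_apply, ← hc, map_sum]
    exact Finset.sum_congr rfl fun i _ => by rw [map_zsmul, zsmul_eq_mul]; rfl
  have key := congrArg (Algebra.trace K (adjoin K (Set.range y))) hsum
  rw [Algebra.trace_algebraMap, map_sum] at key
  have hzero : ∑ i, Algebra.trace K (adjoin K (Set.range y)) (a i • w i) = 0 := by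
    rcases isEmpty_or_nonempty ι with h | ⟨⟨i₀⟩⟩
    · simp
    · simp_rw [map_zsmul, fun i => htr i i₀, ← Finset.sum_smul, ha, zero_smul]
  rw [hzero] at key
  exact (smul_eq_zero.mp key.symm).resolve_left Module.finrank_pos.ne'

open IntermediateField in
/-- If `t` is transcendental over `k`, two roots of `F = t` satisfy the same algebraic equations
over `k(t)`. -/
theorem aeval_eq_zero_of_aeval_eq {k Ω : Type*} [Field k] [Field Ω] [Algebra k Ω]
    {x x' t : Ω} (hx : Transcendental k x) (hx' : Transcendental k x') (F : k[X])
    (hF : aeval x F = t) (hF' : aeval x' F = t) (q : k⟮t⟯[X]) (hq : aeval x q = 0) :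
    aeval x' q = 0 := by
  let σ : k⟮x⟯ →ₐ[k] Ω := (val k⟮x'⟯).comp
    (((RatFunc.algEquivOfTranscendental x hx).symm.trans
      (RatFunc.algEquivOfTranscendental x' hx')).toAlgHom)
  have hσ : ∀ P : k[X], σ (aeval (AdjoinSimple.gen k x) P) = aeval x' P := by
    intro P
    simp [σ]
  have hle : k⟮t⟯ ≤ k⟮x⟯ := by
    rw [adjoin_simple_le_iff, ← hF]
    exact algebra_adjoin_le_adjoin k {x} (aeval_mem_adjoin_singleton k x)
  have hfix : σ.comp (inclusion hle) = val k⟮t⟯ := by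
    apply adjoin_algHom_ext
    intro s hs
    obtain rfl : s = t := hs
    have : inclusion hle ⟨s, subset_adjoin _ _ rfl⟩ = aeval (AdjoinSimple.gen k x) F := by
      apply Subtype.ext
      simpa using hF.symm
    change σ (inclusion hle _) = s
    rw [this, hσ, hF']
  have h0 : eval₂ (inclusion hle : k⟮t⟯ →+* k⟮x⟯) (AdjoinSimple.gen k x) q = 0 := by
    apply (val k⟮x⟯).injective
    rw [map_zero, ← hq, aeval_def]
    change (val k⟮x⟯ : k⟮x⟯ →+* Ω) _ = _
    rw [hom_eval₂]
    rfl
  have h1 := congrArg (σ : k⟮x⟯ →+* Ω) h0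
  rw [hom_eval₂, map_zero] at h1
  rw [aeval_def, ← h1]
  congr 1
  · exact congrArg AlgHom.toRingHom hfix.symm
  · simpa using (hσ X).symm

/-- On an open set, a combination with integer weights of total sum zero of the values of a
polynomial `G` at roots of `F = t` can be constant in `t` only if the constant is zero. -/
theorem eq_zero_of_sum_branches_eq_const {ι : Type*} [Fintype ι] (F G : ℂ[X]) (c : ℂ) (U : Set ℂ)
    (hU : IsOpen U) (hne : U.Nonempty) (x : ι → ℂ → ℂ)
    (hx : ∀ i, ∀ t ∈ U, F.eval (x i t) = t) (a : ι → ℤ) (ha : ∑ i, a i = 0)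
    (hc : ∀ t ∈ U, ∑ i, (a i : ℂ) * G.eval (x i t) = c) : c = 0 := by
  let S : Set ℂ := ↑F.coeffs ∪ ↑G.coeffs ∪ {c}
  have hS : S.Countable :=
    ((F.coeffs.countable_toSet.union G.coeffs.countable_toSet).union (Set.countable_singleton c))
  let k := Subfield.closure S
  have hk : Countable k := by
    rw [← Cardinal.mk_le_aleph0_iff]
    exact (Subfield.cardinalMk_closure_le_max S).trans
      (max_le (Cardinal.mk_le_aleph0_iff.mpr hS) le_rfl)
  have hlift : ∀ P : ℂ[X], (↑P.coeffs : Set ℂ) ⊆ S → ∃ Q : k[X], Q.map (algebraMap k ℂ) = P := by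
    intro P hP
    rw [← mem_lifts, lifts_iff_coeff_lifts]
    intro n
    by_cases h0 : P.coeff n = 0
    · exact ⟨0, by simp [h0]⟩
    · exact ⟨⟨_, Subfield.subset_closure (hP (coeff_mem_coeffs h0))⟩, rfl⟩
  obtain ⟨F', hF'⟩ := hlift F (fun y hy => Or.inl (Or.inl hy))
  obtain ⟨G', hG'⟩ := hlift G (fun y hy => Or.inl (Or.inr hy))
  obtain ⟨t, htU, ht⟩ : ∃ t ∈ U, Transcendental k t := by
    exact ((Algebraic.countable k ℂ).dense_compl ℂ).inter_open_nonempty U hU hne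
  have hroot : ∀ i, aeval (x i t) F' = t := fun i => by
    simpa [← hF', eval_map_algebraMap] using hx i t htU
  have htr : ∀ i, Transcendental k (x i t) := by
    intro i hi
    apply ht
    rw [← hroot i]
    exact isAlgebraic_iff_isIntegral.mpr (IsIntegral.of_mem_of_fg _ hi.isIntegral.fg_adjoin_singleton _
      (aeval_mem_adjoin_singleton k _))
  let K := IntermediateField.adjoin k {t}
  have hint : ∀ i, IsIntegral K (x i t) := by
    intro i
    rw [← isAlgebraic_iff_isIntegral]
    refine ⟨F'.map (algebraMap k K) - C (IntermediateField.AdjoinSimple.gen k t), fun h0 => ?_, ?_⟩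
    · have h1 := congrArg (fun P : K[X] => (P.map (algebraMap K ℂ)).eval t) h0
      have h2 := sub_eq_zero.mp h0
      have hd : F'.natDegree = 0 := by
        have := congrArg natDegree h2
        simpa using this
      rw [eq_C_of_natDegree_eq_zero hd] at hroot
      apply ht
      rw [← hroot i, aeval_C]
      exact isAlgebraic_algebraMap _
    · simp [hroot i]
  have hint' : ∀ i, IsIntegral K (aeval (x i t) G') := fun i => by
    rw [← aeval_map_algebraMap K]
    exact IsIntegral.of_mem_of_fg _ (hint i).fg_adjoin_singleton _
      (aeval_mem_adjoin_singleton K _)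
  have hdvd : ∀ i j, minpoly K (aeval (x i t) G') ∣ minpoly K (aeval (x j t) G') := by
    intro i j
    apply minpoly.dvd
    have h := aeval_eq_zero_of_aeval_eq (htr j) (htr i) F' (hroot j) (hroot i)
      ((minpoly K (aeval (x j t) G')).comp (G'.map (algebraMap k K)))
      (by rw [aeval_comp, aeval_map_algebraMap, minpoly.aeval])
    rwa [aeval_comp, aeval_map_algebraMap] at h
  have hcK : algebraMap k K ⟨c, Subfield.subset_closure (Or.inr rfl)⟩ = 0 := by
    refine eq_zero_of_sum_conjugates a ha (fun i => aeval (x i t) G') hint' (fun i j => ?_) _ ?_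
    · exact eq_of_monic_of_associated (minpoly.monic (hint' i)) (minpoly.monic (hint' j))
        (associated_of_dvd_dvd (hdvd i j) (hdvd j i))
    · rw [← IsScalarTower.algebraMap_apply]
      change _ = c
      have := hc t htU
      simpa [← hG', eval_map_algebraMap] using this
  have := (algebraMap k K).injective (hcK.trans (map_zero _).symm)
  exact congrArg Subtype.val this

open IntermediateField in
/-- A polynomial lying in `K(q)` satisfies `p * R(q) = P(q)` with `P`, `R` coprime. -/
theorem exists_isCoprime_of_mem_adjoin {K : Type*} [Field K] {q p : RatFunc K}
    (hp : p ∈ K⟮q⟯) : ∃ P R : K[X], IsCoprime P R ∧ p * aeval q R = aeval q P := by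
  classical
  obtain ⟨P, R, rfl⟩ := (mem_adjoin_simple_iff K p).mp hp
  by_cases hR : aeval q R = 0
  · exact ⟨0, 1, isCoprime_zero_left.mpr isUnit_one, by simp [hR]⟩
  have hR0 : R ≠ 0 := by rintro rfl; simp at hR
  have hd : EuclideanDomain.gcd P R ≠ 0 := fun h => hR0 (EuclideanDomain.gcd_eq_zero_iff.mp h).2
  obtain ⟨P', hP'⟩ := EuclideanDomain.gcd_dvd_left P R
  obtain ⟨R', hR'⟩ := EuclideanDomain.gcd_dvd_right P R
  refine ⟨P', R', ?_, ?_⟩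
  · obtain ⟨u, v, huv⟩ : ∃ u v, EuclideanDomain.gcd P R = P * u + R * v :=
      ⟨_, _, EuclideanDomain.gcd_eq_gcd_ab P R⟩
    refine ⟨u, v, mul_left_cancel₀ hd ?_⟩
    linear_combination -huv - u * hP' - v * hR'
  · have h1 : aeval q P = aeval q (EuclideanDomain.gcd P R) * aeval q P' := by
      rw [← map_mul, ← hP']
    have h2 : aeval q R = aeval q (EuclideanDomain.gcd P R) * aeval q R' := by
      rw [← map_mul, ← hR']
    have h3 : aeval q (EuclideanDomain.gcd P R) ≠ 0 := fun h => hR (by rw [h2, h, zero_mul])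
    rw [div_mul_eq_mul_div, div_eq_iff hR, h1, h2]
    ring

/-- The inverse of a root of a polynomial with invertible constant coefficient is integral. -/
theorem isIntegral_inv_of_isUnit_coeff_zero {R L : Type*} [CommRing R] [Field L] [Algebra R L]
    (N : R[X]) (hN : IsUnit (N.coeff 0)) (y : L) (hy : aeval y N = 0) : IsIntegral R y⁻¹ := by
  have := (algebraMap R L).domain_nontrivial
  have hy0 : y ≠ 0 := by
    rintro rfl
    rw [← coeff_zero_eq_aeval_zero'] at hy
    exact (hN.map (algebraMap R L)).ne_zero hy
  obtain ⟨u, hu⟩ := hN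
  have htr : N.natTrailingDegree = 0 :=
    natTrailingDegree_eq_zero_of_constantCoeff_ne_zero (by simp [constantCoeff_apply, ← hu])
  have hlead : N.reverse.leadingCoeff = u := by
    rw [reverse_leadingCoeff, trailingCoeff, htr, hu]
  refine ⟨C (↑u⁻¹ : R) * N.reverse, ?_, ?_⟩
  · apply monic_C_mul_of_mul_leadingCoeff_eq_one
    rw [hlead, Units.inv_mul]
  · let := invertibleOfNonzero hy0
    have := (eval₂_reverse_eq_zero_iff (algebraMap R L) y N).mpr hy
    rw [invOf_eq_inv] at this
    rw [eval₂_mul, this, mul_zero]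

open IntermediateField in
/-- A subfield `K(q)` of the field of rational functions containing a nonconstant polynomial is
generated by a polynomial. -/
theorem exists_adjoin_polynomial_eq {K : Type*} [Field K] [IsAlgClosed K] {q : RatFunc K}
    {p : K[X]} (hp0 : 0 < p.natDegree) (hp : algebraMap K[X] (RatFunc K) p ∈ K⟮q⟯) :
    ∃ h : K[X], K⟮algebraMap K[X] (RatFunc K) h⟯ = K⟮q⟯ := by
  obtain ⟨P, R, hcop, heq⟩ := exists_isCoprime_of_mem_adjoin hp
  suffices h : ∃ q' : RatFunc K, K⟮q'⟯ = K⟮q⟯ ∧ IsIntegral K[X] q' by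
    obtain ⟨q', hq', hint⟩ := h
    obtain ⟨h, rfl⟩ := IsIntegrallyClosed.isIntegral_iff.mp hint
    exact ⟨h, hq'⟩
  let N : K[X][X] := P.map C - C p * R.map C
  have hN : aeval q N = 0 := by
    have hC : (C : K →+* K[X]) = algebraMap K K[X] := rfl
    simp only [N, map_sub, map_mul, hC, aeval_map_algebraMap, aeval_C, heq, sub_self]
  by_cases hR : R.natDegree = 0
  · refine ⟨q, rfl, ?_⟩
    obtain ⟨r, rfl⟩ : ∃ r, R = C r := ⟨_, eq_C_of_natDegree_eq_zero hR⟩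
    have hPdeg : 0 < P.natDegree := by
      by_contra! hP
      obtain ⟨s, rfl⟩ : ∃ s, P = C s := ⟨_, eq_C_of_natDegree_le_zero hP⟩
      have hr : r ≠ 0 := by
        rintro rfl
        have hs : s = 0 := by simpa using heq.symm
        subst hs
        rw [C_0] at hcop
        exact not_isCoprime_zero_zero hcop
      have h1 : p * C r = C s := by
        apply IsFractionRing.injective K[X] (RatFunc K)
        simpa using heq
      have h2 := congrArg natDegree h1
      rw [natDegree_mul_C hr, natDegree_C] at h2
      omega
    have hP0 : P ≠ 0 := by rintro rfl; simp at hPdeg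
    refine IsIntegral.of_aeval_monic (p := (P * C P.leadingCoeff⁻¹).map (algebraMap K K[X]))
      ((monic_mul_leadingCoeff_inv hP0).map _) ?_ ?_
    · rw [natDegree_map, natDegree_mul_leadingCoeff_inv _ hP0]
      exact hPdeg.ne'
    · rw [aeval_map_algebraMap, map_mul, ← heq, aeval_C, aeval_C]
      simp only [IsScalarTower.algebraMap_apply K K[X] (RatFunc K), ← map_mul]
      exact isIntegral_algebraMap
  · obtain ⟨r, hr⟩ := IsAlgClosed.exists_root R (fun h => hR (natDegree_eq_of_degree_eq_some h))
    have hPr : P.eval r ≠ 0 := by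
      intro h
      obtain ⟨u, v, huv⟩ := hcop
      have := congrArg (eval r) huv
      simp [h, IsRoot.def.mp hr] at this
    refine ⟨(q - RatFunc.C r)⁻¹, ?_, ?_⟩
    · apply le_antisymm
      · rw [adjoin_simple_le_iff]
        exact inv_mem (sub_mem (mem_adjoin_simple_self K q) (K⟮q⟯.algebraMap_mem r))
      · rw [adjoin_simple_le_iff]
        have h1 := inv_mem (mem_adjoin_simple_self K (q - RatFunc.C r)⁻¹)
        have h2 := add_mem h1 (K⟮(q - RatFunc.C r)⁻¹⟯.algebraMap_mem r)
        rw [inv_inv] at h2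
        simpa using h2
    · apply isIntegral_inv_of_isUnit_coeff_zero (N.comp (X + C (C r)))
      · have : (N.comp (X + C (C r))).coeff 0 = C (P.eval r) := by
          rw [coeff_zero_eq_eval_zero, eval_comp]
          simp [N, eval_map, IsRoot.def.mp hr]
        rw [this, isUnit_C]
        exact hPr.isUnit
      · rw [aeval_comp]
        have : aeval (q - RatFunc.C r) (X + C (C r) : K[X][X]) = q := by
          simp
        rw [this, hN]

/-- A polynomial in the field generated by a nonconstant polynomial `h` is a polynomial in `h`. -/
theorem exists_eq_comp_of_mem_adjoin {K : Type*} [Field K] {h p : K[X]} (hh : 0 < h.natDegree)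
    (hp : algebraMap K[X] (RatFunc K) p ∈
      IntermediateField.adjoin K {algebraMap K[X] (RatFunc K) h}) :
    ∃ s : K[X], p = s.comp h := by
  obtain ⟨P, R, ⟨u, v, huv⟩, heq⟩ := exists_isCoprime_of_mem_adjoin hp
  have hcomp : ∀ Q : K[X], aeval (algebraMap K[X] (RatFunc K) h) Q =
      algebraMap K[X] (RatFunc K) (Q.comp h) := fun Q => by
    rw [aeval_algebraMap_apply]; rfl
  have h1 : p * R.comp h = P.comp h := by
    apply IsFractionRing.injective K[X] (RatFunc K)
    rw [map_mul, ← hcomp, ← hcomp, heq]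
  have h2 : IsUnit (R.comp h) := by
    refine IsUnit.of_mul_eq_one (u.comp h * p + v.comp h) ?_
    have h3 := congrArg (fun Q : K[X] => Q.comp h) huv
    simp only [add_comp, mul_comp, one_comp] at h3
    linear_combination h3 + u.comp h * h1
  have h4 : R.natDegree = 0 := by
    have := natDegree_eq_zero_of_isUnit h2
    rw [natDegree_comp] at this
    exact (mul_eq_zero.mp this).resolve_right hh.ne'
  obtain ⟨r, rfl⟩ : ∃ r, R = C r := ⟨_, eq_C_of_natDegree_eq_zero h4⟩
  rw [C_comp, isUnit_C] at h2
  refine ⟨P * C r⁻¹, ?_⟩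
  rw [mul_comp, C_comp, ← h1, C_comp, mul_assoc, ← C_mul, mul_inv_cancel₀ h2.ne_zero, C_1, mul_one]

/-- Polynomials `f`, `g` with `f` nonconstant factor through a common polynomial `h` which is
generically determined by the values of `f` and `g`. -/
theorem exists_common_right_factor {K : Type*} [Field K] [IsAlgClosed K] (f g : K[X])
    (hf : 0 < f.natDegree) :
    ∃ ftil gtil h B : K[X], f = ftil.comp h ∧ g = gtil.comp h ∧ B ≠ 0 ∧
      ∀ x y, f.eval x = f.eval y → g.eval x = g.eval y → B.eval x ≠ 0 →
        h.eval x = h.eval y := by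
  let v : Bool → K[X] := fun b => if b then f else g
  let E : IntermediateField K (RatFunc K) :=
    IntermediateField.adjoin K (Set.range fun b => algebraMap K[X] (RatFunc K) (v b))
  have hv : ∀ b, algebraMap K[X] (RatFunc K) (v b) ∈ E := fun b =>
    IntermediateField.subset_adjoin _ _ ⟨b, rfl⟩
  have hE := RatFunc.Luroth.eq_adjoin_generator (E := E)
  obtain ⟨h, hh⟩ := exists_adjoin_polynomial_eq hf (hE ▸ hv true)
  rw [← hE] at hh
  have hdeg : 0 < h.natDegree := by
    by_contra! h0
    obtain ⟨s, rfl⟩ : ∃ s, h = C s := ⟨_, eq_C_of_natDegree_le_zero h0⟩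
    have h1 := hv true
    rw [← hh, (IntermediateField.adjoin_simple_eq_bot_iff).mpr, IntermediateField.mem_bot] at h1
    · obtain ⟨y, hy⟩ := h1
      have h2 : C y = f := by
        apply IsFractionRing.injective K[X] (RatFunc K)
        simpa [v] using hy
      rw [← h2, natDegree_C] at hf
      exact hf.false
    · exact IntermediateField.mem_bot.mpr ⟨s, by simp⟩
  obtain ⟨ftil, hftil⟩ := exists_eq_comp_of_mem_adjoin hdeg (hh ▸ hv true)
  obtain ⟨gtil, hgtil⟩ := exists_eq_comp_of_mem_adjoin hdeg (hh ▸ hv false)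
  have hmem : algebraMap K[X] (RatFunc K) h ∈ E :=
    hh ▸ IntermediateField.mem_adjoin_simple_self K _
  obtain ⟨r, s, hrs⟩ := (IntermediateField.mem_adjoin_range_iff K _ _).mp hmem
  have haev : ∀ Q : MvPolynomial Bool K,
      MvPolynomial.aeval (fun b => algebraMap K[X] (RatFunc K) (v b)) Q =
        algebraMap K[X] (RatFunc K) (MvPolynomial.aeval v Q) := fun Q =>
    MvPolynomial.aeval_algebraMap_apply ..
  have heval : ∀ (Q : MvPolynomial Bool K) (x : K), (MvPolynomial.aeval v Q).eval x =
      MvPolynomial.eval (fun b => (v b).eval x) Q := by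
    intro Q x
    rw [← coe_evalRingHom, MvPolynomial.aeval_def, MvPolynomial.hom_eval₂, MvPolynomial.eval,
      MvPolynomial.coe_eval₂Hom]
    congr 1
    ext; simp
  have hB : MvPolynomial.aeval v s ≠ 0 := by
    intro h0
    rw [haev s, h0, map_zero, div_zero, map_eq_zero_iff _ (IsFractionRing.injective _ _)] at hrs
    simp [hrs] at hdeg
  refine ⟨ftil, gtil, h, MvPolynomial.aeval v s, hftil, hgtil, hB, fun x y hfxy hgxy hBx => ?_⟩
  have hmul : h * MvPolynomial.aeval v s = MvPolynomial.aeval v r := by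
    apply IsFractionRing.injective K[X] (RatFunc K)
    rw [map_mul, hrs, haev, haev, div_mul_cancel₀]
    rwa [Ne, map_eq_zero_iff _ (IsFractionRing.injective _ _)]
  have hvxy : (fun b => (v b).eval x) = fun b => (v b).eval y := by
    ext (_ | _) <;> simp [v, hfxy, hgxy]
  have hx := congrArg (eval x) hmul
  have hy := congrArg (eval y) hmul
  rw [eval_mul, heval, heval] at hx hy
  rw [heval] at hBx
  rw [← hvxy, ← hx] at hy
  exact (mul_right_cancel₀ hBx hy).symm

/-- The divided difference of a polynomial extends continuously to the diagonal. -/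
theorem exists_continuous_divided_difference (P : ℂ[X]) :
    ∃ Q : ℂ × ℂ → ℂ, Continuous Q ∧ (∀ x y, P.eval x - P.eval y = (x - y) * Q (x, y)) ∧
      ∀ x, Q (x, x) = P.derivative.eval x := by
  induction P using Polynomial.induction_on with
  | C c => exact ⟨0, continuous_const, by simp, by simp⟩
  | add p q hp hq =>
    obtain ⟨Q₁, hc₁, hd₁, he₁⟩ := hp
    obtain ⟨Q₂, hc₂, hd₂, he₂⟩ := hq
    refine ⟨fun z => Q₁ z + Q₂ z, hc₁.add hc₂, fun x y => ?_, fun x => ?_⟩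
    · simp only [eval_add]
      linear_combination hd₁ x y + hd₂ x y
    · simp [he₁, he₂]
  | monomial n c h =>
    obtain ⟨Q, hc, hd, he⟩ := h
    refine ⟨fun z => (C c * X ^ n : ℂ[X]).eval z.1 + z.2 * Q z, by fun_prop,
      fun x y => ?_, fun x => ?_⟩
    · rw [pow_succ, ← mul_assoc, eval_mul_X, eval_mul_X]
      linear_combination y * hd x y
    · simp only [he, pow_succ, ← mul_assoc, derivative_mul, derivative_X, eval_add, eval_mul,
        eval_X, mul_one]
      ring

/-- A continuous local right inverse of a polynomial only takes noncritical values. -/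
theorem derivative_eval_ne_zero_of_continuous_rightInverse (F : ℂ[X]) {U : Set ℂ} (hU : IsOpen U)
    {w : ℂ → ℂ} (hw : ContinuousOn w U) (hFw : ∀ t ∈ U, F.eval (w t) = t) {t : ℂ} (ht : t ∈ U) :
    F.derivative.eval (w t) ≠ 0 := by
  have hF' : F.derivative ≠ 0 := by
    intro h
    rw [eq_C_of_natDegree_eq_zero (derivative_eq_zero.mp h)] at hFw
    simp only [eval_C] at hFw
    have hsub : U ⊆ {F.coeff 0} := fun s hs => (hFw s hs).symm
    exact (infinite_of_mem_nhds t (hU.mem_nhds ht)) ((Set.finite_singleton _).subset hsub)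
  let B : Set ℂ := (fun z => F.eval z) '' {z | F.derivative.IsRoot z}
  have hB : B.Finite := (finite_setOfPred_isRoot hF').image _
  have hdiff : ∀ᶠ s in nhdsWithin t {t}ᶜ, DifferentiableAt ℂ w s := by
    have h1 : ∀ᶠ s in nhdsWithin t {t}ᶜ, s ∈ U := nhdsWithin_le_nhds (hU.mem_nhds ht)
    have h2 : ∀ᶠ s in nhdsWithin t {t}ᶜ, s ∉ B \ {t} := by
      apply nhdsWithin_le_nhds
      exact (hB.subset Set.sdiff_subset).isClosed.isOpen_compl.mem_nhds (by simp)
    filter_upwards [h1, h2, self_mem_nhdsWithin] with s hs hsB hst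
    have hne : F.derivative.eval (w s) ≠ 0 := fun h => hsB ⟨⟨w s, h, hFw s hs⟩, hst⟩
    refine (HasDerivAt.of_local_left_inverse (hw.continuousAt (hU.mem_nhds hs))
      (F.hasDerivAt (w s)) hne ?_).differentiableAt
    filter_upwards [hU.mem_nhds hs] with y hy using hFw y hy
  have hd := (Complex.analyticAt_of_differentiable_on_punctured_nhds_of_continuousAt hdiff
    (hw.continuousAt (hU.mem_nhds ht))).differentiableAt.hasDerivAt
  have hid : HasDerivAt (fun s => F.eval (w s)) 1 t := by
    refine (hasDerivAt_id t).congr_of_eventuallyEq ?_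
    filter_upwards [hU.mem_nhds ht] with y hy using hFw y hy
  intro h0
  have := ((F.hasDerivAt (w t)).comp t hd).unique hid
  simp [h0] at this

/-- The derivative in the parameter of a continuous branch of simple roots of `f + ε g = t`. -/
theorem hasDerivAt_root_branch (f g : ℂ[X]) (t ε : ℂ) (w : ℂ → ℂ) (hw : ContinuousAt w ε)
    (hroot : ∀ᶠ e in nhds ε, f.eval (w e) + e * g.eval (w e) = t)
    (hne : (f + C ε * g).derivative.eval (w ε) ≠ 0) :
    HasDerivAt w (-g.eval (w ε) / (f + C ε * g).derivative.eval (w ε)) ε := by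
  obtain ⟨Qf, hcf, hdf, hef⟩ := exists_continuous_divided_difference f
  obtain ⟨Qg, hcg, hdg, heg⟩ := exists_continuous_divided_difference g
  let D : ℂ → ℂ := fun e => Qf (w e, w ε) + e * Qg (w e, w ε)
  have hDε : D ε = (f + C ε * g).derivative.eval (w ε) := by simp [D, hef, heg]
  have hpair : ContinuousAt (fun e => (w e, w ε)) ε := hw.prodMk continuousAt_const
  have hD : ContinuousAt D ε :=
    (hcf.continuousAt.comp hpair).add (continuousAt_id.mul (hcg.continuousAt.comp hpair))
  rw [hasDerivAt_iff_tendsto_slope, ← hDε]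
  have hlim : Filter.Tendsto (fun e => -g.eval (w ε) / D e) (nhdsWithin ε {ε}ᶜ)
      (nhds (-g.eval (w ε) / D ε)) :=
    (continuousAt_const.div hD (hDε ▸ hne)).tendsto.mono_left nhdsWithin_le_nhds
  refine hlim.congr' ?_
  have h1 : ∀ᶠ e in nhdsWithin ε {ε}ᶜ, D e ≠ 0 :=
    nhdsWithin_le_nhds (hD.eventually_ne (hDε ▸ hne))
  have h2 := nhdsWithin_le_nhds (s := {ε}ᶜ) hroot
  filter_upwards [h1, h2, self_mem_nhdsWithin] with e he hre hne'
  rw [slope_def_field, div_eq_div_iff he (sub_ne_zero.mpr hne')]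
  have := hroot.self_of_nhds
  simp only [D]
  linear_combination hdf (w e) (w ε) + e * hdg (w e) (w ε) - hre + this

/-- Two continuous families of roots of `P + ε Q = t` which coincide at a simple root coincide
nearby. -/
theorem eventually_eq_of_simple_root {T : Type*} [TopologicalSpace T] (P Q : ℂ[X]) (s : T)
    {e τ u v : T → ℂ} (he : ContinuousAt e s) (hu : ContinuousAt u s) (hv : ContinuousAt v s)
    (huv : u s = v s) (hne : (P + C (e s) * Q).derivative.eval (u s) ≠ 0)
    (hru : ∀ᶠ p in nhds s, P.eval (u p) + e p * Q.eval (u p) = τ p)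
    (hrv : ∀ᶠ p in nhds s, P.eval (v p) + e p * Q.eval (v p) = τ p) :
    ∀ᶠ p in nhds s, u p = v p := by
  obtain ⟨A, hcA, hdA, heA⟩ := exists_continuous_divided_difference P
  obtain ⟨B, hcB, hdB, heB⟩ := exists_continuous_divided_difference Q
  have hpair : ContinuousAt (fun p => (u p, v p)) s := hu.prodMk hv
  have hD : ContinuousAt (fun p => A (u p, v p) + e p * B (u p, v p)) s :=
    (hcA.continuousAt.comp hpair).add (he.mul (hcB.continuousAt.comp hpair))
  have hDs : A (u s, v s) + e s * B (u s, v s) ≠ 0 := by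
    rw [← huv, heA, heB]
    simpa using hne
  filter_upwards [hru, hrv, hD.eventually_ne hDs] with p hp hq hDp
  have h0 : (u p - v p) * (A (u p, v p) + e p * B (u p, v p)) = 0 := by
    linear_combination hp - hq - hdA (u p) (v p) - e p * hdB (u p) (v p)
  exact sub_eq_zero.mp ((mul_eq_zero.mp h0).resolve_right hDp)

/-- If all power sums of `y` weighted by `a` vanish, the weights cancel on each fibre of `y`. -/
theorem sum_fiber_eq_zero_of_forall_sum_pow_eq_zero {ι K : Type*} [Fintype ι] [Field K]
    [CharZero K] [DecidableEq K] (a : ι → ℤ) (y : ι → K)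
    (h : ∀ k : ℕ, ∑ i, (a i : K) * y i ^ k = 0) (b : K) :
    ∑ j ∈ univ.filter fun j => y j = b, a j = 0 := by
  have hpoly : ∀ P : K[X], ∑ i, (a i : K) * P.eval (y i) = 0 := by
    intro P
    simp_rw [eval_eq_sum_range, Finset.mul_sum]
    rw [Finset.sum_comm]
    refine Finset.sum_eq_zero fun k _ => ?_
    rw [← mul_zero (P.coeff k), ← h k, Finset.mul_sum]
    exact Finset.sum_congr rfl fun i _ => by ring
  let P : K[X] := ∏ v ∈ (univ.image y).erase b, (X - C v)
  have hPb : P.eval b ≠ 0 := by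
    rw [eval_prod, Finset.prod_ne_zero_iff]
    intro v hv
    simpa [sub_eq_zero] using (Finset.ne_of_mem_erase hv).symm
  have hP : ∀ i, y i ≠ b → P.eval (y i) = 0 := by
    intro i hi
    rw [eval_prod]
    exact Finset.prod_eq_zero (Finset.mem_erase.mpr ⟨hi, Finset.mem_image_of_mem y (mem_univ i)⟩)
      (by simp)
  have hsum : (∑ j ∈ univ.filter fun j => y j = b, (a j : K)) * P.eval b = 0 := by
    rw [← hpoly P, Finset.sum_mul, Finset.sum_filter]
    refine Finset.sum_congr rfl fun i _ => ?_
    split_ifs with hi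
    · rw [hi]
    · rw [hP i hi, mul_zero]
  have := (mul_eq_zero.mp hsum).resolve_right hPb
  exact_mod_cast this

section Branches

variable {ι : Type*} {f g : ℂ[X]} {t₀ : ℂ} {δ r : ℝ} {z : ι → ℂ → ℂ → ℂ}

/-- Continuous root branches of `f + ε g = t` on a polydisc are simple roots. -/
theorem derivative_eval_branch_ne_zero
    (hcont : ∀ i, ContinuousOn (fun p : ℂ × ℂ => z i p.1 p.2) (ball t₀ δ ×ˢ ball 0 r))
    (hroot : ∀ i, ∀ t ∈ ball t₀ δ, ∀ ε ∈ ball (0 : ℂ) r,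
      f.eval (z i t ε) + ε * g.eval (z i t ε) = t)
    (i : ι) {t ε : ℂ} (ht : t ∈ ball t₀ δ) (hε : ε ∈ ball (0 : ℂ) r) :
    (f + C ε * g).derivative.eval (z i t ε) ≠ 0 :=
  derivative_eval_ne_zero_of_continuous_rightInverse (f + C ε * g) isOpen_ball
    (w := fun s => z i s ε)
    ((hcont i).comp (f := fun s => (s, ε)) (by fun_prop) fun _ hs => ⟨hs, hε⟩)
    (fun s hs => by simpa using hroot i s hs ε hε) ht

/-- If the displacement function vanishes, so do all weighted power sums of the values of `g`. -/
theorem sum_pow_eq_zero_of_displacement_eq_zero [Fintype ι] {a : ι → ℤ} (ha : ∑ i, a i = 0)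
    (hcont : ∀ i, ContinuousOn (fun p : ℂ × ℂ => z i p.1 p.2) (ball t₀ δ ×ˢ ball 0 r))
    (hroot : ∀ i, ∀ t ∈ ball t₀ δ, ∀ ε ∈ ball (0 : ℂ) r,
      f.eval (z i t ε) + ε * g.eval (z i t ε) = t)
    (hΔ : ∀ t ∈ ball t₀ δ, ∀ ε ∈ ball (0 : ℂ) r, ∑ i, (a i : ℂ) * f.eval (z i t ε) = 0)
    (k : ℕ) : ∀ t ∈ ball t₀ δ, ∀ ε ∈ ball (0 : ℂ) r, ε ≠ 0 →
      ∑ i, (a i : ℂ) * g.eval (z i t ε) ^ k = 0 := by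
  have haC : ∑ i, (a i : ℂ) = 0 := by exact_mod_cast ha
  have hsimple := fun i t (ht : t ∈ ball t₀ δ) ε (hε : ε ∈ ball (0 : ℂ) r) =>
    derivative_eval_branch_ne_zero hcont hroot i ht hε
  have hcontAt : ∀ i t, t ∈ ball t₀ δ → ∀ ε, ε ∈ ball (0 : ℂ) r →
      ContinuousAt (fun p : ℂ × ℂ => z i p.1 p.2) (t, ε) := fun i t ht ε hε =>
    (hcont i).continuousAt ((isOpen_ball.prod isOpen_ball).mem_nhds ⟨ht, hε⟩)
  rcases k with _ | k
  · simpa using fun _ _ _ _ _ => haC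
  induction k with
  | zero =>
    intro t ht ε hε hε0
    have h : ε * ∑ i, (a i : ℂ) * g.eval (z i t ε) ^ (0 + 1) = 0 := by
      calc ε * ∑ i, (a i : ℂ) * g.eval (z i t ε) ^ (0 + 1)
          = ∑ i, ((a i : ℂ) * t - a i * f.eval (z i t ε)) := by
            rw [Finset.mul_sum]
            refine Finset.sum_congr rfl fun i _ => ?_
            linear_combination (a i : ℂ) * hroot i t ht ε hε
        _ = 0 := by rw [Finset.sum_sub_distrib, ← Finset.sum_mul, haC, hΔ t ht ε hε]; ring
    exact (mul_eq_zero.mp h).resolve_left hε0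
  | succ k ih =>
    have hgrad : ∀ t ∈ ball t₀ δ, ∀ ε ∈ ball (0 : ℂ) r, ε ≠ 0 →
        ∑ i, (a i : ℂ) * (g.eval (z i t ε) ^ (k + 1) * g.derivative.eval (z i t ε) /
          (f + C ε * g).derivative.eval (z i t ε)) = 0 := by
      intro t ht ε hε hε0
      have hd : HasDerivAt (fun e => ∑ i, (a i : ℂ) * g.eval (z i t e) ^ (k + 1))
          (∑ i, (a i : ℂ) * (((k + 1 : ℕ) : ℂ) * g.eval (z i t ε) ^ k *
            (g.derivative.eval (z i t ε) *
              (-g.eval (z i t ε) / (f + C ε * g).derivative.eval (z i t ε))))) ε := by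
        refine HasDerivAt.fun_sum fun i _ => HasDerivAt.const_mul _ ?_
        have hc : ContinuousAt (fun e => z i t e) ε :=
          ContinuousAt.comp (f := fun e => (t, e)) (hcontAt i t ht ε hε) (by fun_prop)
        have hb := hasDerivAt_root_branch f g t ε (fun e => z i t e) hc
          (by filter_upwards [isOpen_ball.mem_nhds hε] with e he using hroot i t ht e he)
          (hsimple i t ht ε hε)
        exact ((g.hasDerivAt (z i t ε)).comp ε hb).fun_pow (k + 1)
      have hd0 : HasDerivAt (fun e => ∑ i, (a i : ℂ) * g.eval (z i t e) ^ (k + 1)) 0 ε := by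
        refine (hasDerivAt_const ε (0 : ℂ)).congr_of_eventuallyEq ?_
        filter_upwards [isOpen_ball.mem_nhds hε, isOpen_ne.mem_nhds hε0] with e he he0
        exact ih t ht e he he0
      have h := hd.unique hd0
      have hk : -((k + 1 : ℕ) : ℂ) ≠ 0 := neg_ne_zero.mpr (Nat.cast_ne_zero.mpr k.succ_ne_zero)
      refine (mul_eq_zero.mp (Eq.trans ?_ h)).resolve_left hk
      rw [Finset.mul_sum]
      exact Finset.sum_congr rfl fun i _ => by ring
    intro t ht ε hε hε0
    have hd : ∀ s ∈ ball t₀ δ,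
        HasDerivAt (fun s => ∑ i, (a i : ℂ) * g.eval (z i s ε) ^ (k + 1 + 1)) 0 s := by
      intro s hs
      have h : HasDerivAt (fun s => ∑ i, (a i : ℂ) * g.eval (z i s ε) ^ (k + 1 + 1))
          (∑ i, (a i : ℂ) * (((k + 1 + 1 : ℕ) : ℂ) * g.eval (z i s ε) ^ (k + 1) *
            (g.derivative.eval (z i s ε) *
              ((f + C ε * g).derivative.eval (z i s ε))⁻¹))) s := by
        refine HasDerivAt.fun_sum fun i _ => HasDerivAt.const_mul _ ?_
        have hc : ContinuousAt (fun s => z i s ε) s :=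
          ContinuousAt.comp (f := fun s => (s, ε)) (hcontAt i s hs ε hε) (by fun_prop)
        have hb : HasDerivAt (fun s => z i s ε) ((f + C ε * g).derivative.eval (z i s ε))⁻¹ s := by
          refine HasDerivAt.of_local_left_inverse hc ((f + C ε * g).hasDerivAt _)
            (hsimple i s hs ε hε) ?_
          filter_upwards [isOpen_ball.mem_nhds hs] with y hy
          simpa using hroot i y hy ε hε
        exact ((g.hasDerivAt (z i s ε)).comp s hb).fun_pow (k + 1 + 1)
      convert h using 1
      rw [← mul_zero ((k + 1 + 1 : ℕ) : ℂ), ← hgrad s hs ε hε hε0, Finset.mul_sum]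
      exact Finset.sum_congr rfl fun i _ => by ring
    refine eq_zero_of_sum_branches_eq_const (f + C ε * g) (g ^ (k + 1 + 1)) _ (ball t₀ δ)
      isOpen_ball ⟨t, ht⟩ (fun i s => z i s ε) (fun i s hs => by simpa using hroot i s hs ε hε)
      a ha fun s hs => ?_
    simp only [eval_pow]
    exact isOpen_ball.is_const_of_deriv_eq_zero (convex_ball t₀ δ).isPreconnected
      (fun x hx => (hd x hx).differentiableAt.differentiableWithinAt)
      (fun x hx => (hd x hx).deriv) hs ht

/-- If `f` and `g` factor through `h`, two branches of `f + ε g = t` with the same image under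
`h` at one point have the same image everywhere. -/
theorem eval_branch_eq_of_eval_branch_eq {ftil gtil h : ℂ[X]} (hf : f = ftil.comp h)
    (hg : g = gtil.comp h)
    (hcont : ∀ i, ContinuousOn (fun p : ℂ × ℂ => z i p.1 p.2) (ball t₀ δ ×ˢ ball 0 r))
    (hroot : ∀ i, ∀ t ∈ ball t₀ δ, ∀ ε ∈ ball (0 : ℂ) r,
      f.eval (z i t ε) + ε * g.eval (z i t ε) = t)
    (i j : ι) {p q : ℂ × ℂ} (hp : p ∈ ball t₀ δ ×ˢ ball (0 : ℂ) r)
    (hq : q ∈ ball t₀ δ ×ˢ ball (0 : ℂ) r)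
    (heq : h.eval (z i p.1 p.2) = h.eval (z j p.1 p.2)) :
    h.eval (z i q.1 q.2) = h.eval (z j q.1 q.2) := by
  let D : Set (ℂ × ℂ) := ball t₀ δ ×ˢ ball (0 : ℂ) r
  have hD : IsOpen D := isOpen_ball.prod isOpen_ball
  have hDc : IsPreconnected D :=
    ((convex_ball t₀ δ).prod (convex_ball (0 : ℂ) r)).isPreconnected
  let w : ι → ℂ × ℂ → ℂ := fun i p => h.eval (z i p.1 p.2)
  have hw : ∀ i, ∀ p ∈ D, ContinuousAt (w i) p := fun i p hp =>
    h.continuous.continuousAt.comp ((hcont i).continuousAt (hD.mem_nhds hp))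
  have hu : IsOpen {p ∈ D | w i p = w j p} := by
    rw [isOpen_iff_mem_nhds]
    rintro s ⟨hs, hws⟩
    have hr : ∀ i, ∀ᶠ p : ℂ × ℂ in nhds s,
        ftil.eval (w i p) + p.2 * gtil.eval (w i p) = p.1 := by
      intro i
      filter_upwards [hD.mem_nhds hs] with p hp
      simpa [hf, hg, w] using hroot i p.1 hp.1 p.2 hp.2
    have hne : (ftil + C s.2 * gtil).derivative.eval (w i s) ≠ 0 := by
      intro h0
      apply derivative_eval_branch_ne_zero hcont hroot i hs.1 hs.2
      have hcomp : f + C s.2 * g = (ftil + C s.2 * gtil).comp h := by simp [hf, hg]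
      rw [hcomp, derivative_comp, eval_mul, eval_comp, h0, mul_zero]
    have := eventually_eq_of_simple_root ftil gtil s (e := Prod.snd) (τ := Prod.fst)
      continuousAt_snd (hw i s hs) (hw j s hs) hws hne (hr i) (hr j)
    filter_upwards [hD.mem_nhds hs, this] with p hp hpe using ⟨hp, hpe⟩
  have hv : IsOpen {p ∈ D | w i p ≠ w j p} := by
    rw [isOpen_iff_mem_nhds]
    rintro s ⟨hs, hws⟩
    have hne : ∀ᶠ p in nhds s, w i p - w j p ≠ 0 :=
      ((hw i s hs).sub (hw j s hs)).eventually_ne (sub_ne_zero.mpr hws)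
    filter_upwards [hD.mem_nhds hs, hne] with p hp hpe using ⟨hp, sub_ne_zero.mp hpe⟩
  have hsub := hDc.subset_left_of_subset_union hu hv
    (Set.disjoint_left.mpr fun x hx hx' => hx'.2 hx.2)
    (fun x hx => (em (w i x = w j x)).imp (fun h => ⟨hx, h⟩) fun h => ⟨hx, h⟩)
    ⟨p, hp, hp, heq⟩
  exact (hsub hq).2

end Branches

/-- The image of a weighted sum under a map vanishes if the weights cancel on each fibre. -/
theorem sum_mul_eq_zero_of_sum_fiber_eq_zero {ι κ R : Type*} [Fintype ι] [DecidableEq κ]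
    [CommRing R] (a : ι → ℤ) (y : ι → κ) (φ : κ → R)
    (h : ∀ i, ∑ j ∈ univ.filter fun j => y j = y i, a j = 0) :
    ∑ i, (a i : R) * φ (y i) = 0 := by
  rw [← Finset.sum_fiberwise_of_maps_to (g := y) (t := univ.image y)
    fun i _ => Finset.mem_image_of_mem y (mem_univ i)]
  refine Finset.sum_eq_zero fun b hb => ?_
  obtain ⟨i, -, rfl⟩ := Finset.mem_image.mp hb
  calc ∑ j ∈ univ.filter (fun j => y j = y i), (a j : R) * φ (y j)
      = ∑ j ∈ univ.filter (fun j => y j = y i), (a j : R) * φ (y i) :=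
        Finset.sum_congr rfl fun j hj => by rw [(Finset.mem_filter.mp hj).2]
    _ = 0 := by rw [← Finset.sum_mul, ← Int.cast_sum, h i, Int.cast_zero, zero_mul]

theorem displacement_vanishes_iff_composition_condition
    (f g : Polynomial ℂ) (m : ℕ) (hm : 1 ≤ m) (hdeg : f.natDegree = m)
    (a : Fin m → ℤ) (hcycle : ∑ i, a i = 0)
    (t₀ : ℂ) (δ r : ℝ) (hδ : 0 < δ) (hr : 0 < r)
    (hreg : ∀ w : ℂ, f.eval w = t₀ → f.derivative.eval w ≠ 0)
    (z : Fin m → ℂ → ℂ → ℂ)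
    (hcont : ∀ i, ContinuousOn (fun p : ℂ × ℂ => z i p.1 p.2) (ball t₀ δ ×ˢ ball 0 r))
    (hroot : ∀ i, ∀ t ∈ ball t₀ δ, ∀ ε ∈ ball (0 : ℂ) r,
      f.eval (z i t ε) + ε * g.eval (z i t ε) = t)
    (hsep : ∀ i j, i ≠ j → ∀ t ∈ ball t₀ δ, ∀ ε ∈ ball (0 : ℂ) r, z i t ε ≠ z j t ε) :
    (∀ t ∈ ball t₀ δ, ∀ ε ∈ ball (0 : ℂ) r,
        ∑ i, (a i : ℂ) * f.eval (z i t ε) = 0)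
      ↔ ∃ ftil gtil h : Polynomial ℂ,
          f = ftil.comp h ∧ g = gtil.comp h ∧
          ∀ t ∈ ball t₀ δ, ∀ ε ∈ ball (0 : ℂ) r, ∀ i,
            ∑ j ∈ univ.filter fun j => h.eval (z j t ε) = h.eval (z i t ε), a j = 0 := by
  constructor
  · intro hΔ
    obtain ⟨ftil, gtil, h, B, hf, hg, hB, hsepar⟩ :=
      exists_common_right_factor f g (hdeg ▸ hm)
    refine ⟨ftil, gtil, h, hf, hg, fun t ht ε hε i => ?_⟩
    obtain ⟨e, heb, he0⟩ : ∃ e ∈ ball (0 : ℂ) r, e ≠ 0 := by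
      refine ⟨(r / 2 : ℝ), ?_, ?_⟩
      · simpa [abs_of_pos hr] using hr
      · exact_mod_cast (half_pos hr).ne'
    obtain ⟨s, hs, hsB⟩ : ∃ s ∈ ball t₀ δ, ∀ x, f.eval x + e * g.eval x = s → B.eval x ≠ 0 := by
      have hfin : ((fun x => f.eval x + e * g.eval x) '' {x | B.IsRoot x}).Finite :=
        (finite_setOfPred_isRoot hB).image _
      obtain ⟨s, hs, hs'⟩ := ((hfin.countable.dense_compl ℂ).inter_open_nonempty _ isOpen_ball
        ⟨t₀, mem_ball_self hδ⟩)
      exact ⟨s, hs, fun x hx h0 => hs' ⟨x, h0, hx⟩⟩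
    have hiff : ∀ j, h.eval (z j t ε) = h.eval (z i t ε) ↔
        g.eval (z j s e) = g.eval (z i s e) := by
      intro j
      constructor
      · intro hji
        have := eval_branch_eq_of_eval_branch_eq hf hg hcont hroot j i (p := (t, ε)) (q := (s, e))
          ⟨ht, hε⟩ ⟨hs, heb⟩ hji
        rw [hg, eval_comp, eval_comp, this]
      · intro hji
        have hfji : f.eval (z j s e) = f.eval (z i s e) := by
          linear_combination hroot j s hs e heb - hroot i s hs e heb - e * hji
        exact eval_branch_eq_of_eval_branch_eq hf hg hcont hroot j i (p := (s, e)) (q := (t, ε))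
          ⟨hs, heb⟩ ⟨ht, hε⟩ (hsepar _ _ hfji hji (hsB _ (hroot j s hs e heb)))
    rw [Finset.filter_congr fun j _ => hiff j]
    exact sum_fiber_eq_zero_of_forall_sum_pow_eq_zero a (fun j => g.eval (z j s e))
      (fun k => sum_pow_eq_zero_of_displacement_eq_zero hcycle hcont hroot hΔ k s hs e heb he0) _
  · rintro ⟨ftil, gtil, h, hf, -, hfib⟩ t ht ε hε
    simp only [hf, eval_comp]
    exact sum_mul_eq_zero_of_sum_fiber_eq_zero a (fun i => h.eval (z i t ε))
      (fun b => ftil.eval b) (hfib t ht ε hε)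
end

section
/- Let f, g ∈ ℂ[z], let C be a zero cycle of f, and suppose f, g and C satisfy the composition condition with composition factor h. Then the displacement function vanishes identically: Δ(t,ε) = Σ_{j=1}^m n_j f(z_j(t,ε)) = Σ_{j=1}^m n_j f̃(h(z_j(t,ε))) ≡ 0 for all regular values t and all ε. -/
/-!
STATEMENT 1 (sufficiency of the composition condition).

If `f, g ∈ ℂ[z]` and a zero cycle `C` of `f` satisfy the composition condition
(`f = f̃ ∘ h`, `g = g̃ ∘ h`, and for every `ε` the cycle `C_ε` projected by `h`
is trivial), then the displacement function vanishes identically: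
`Δ(t,ε) = ∑ j, a j * f (z j t ε) = ∑ j, a j * f̃ (h (z j t ε)) ≡ 0`.
The multivalued root branches are modelled as in STATEMENT 0.
-/

open Polynomial Metric Finset

/-- If the integer weights `a` sum to zero over every fibre of `p`, then so does the weighted sum of
any function that factors through `p`. -/
theorem sum_intCast_mul_comp_eq_zero {ι κ R : Type*} [Fintype ι] [DecidableEq κ] [Ring R]
    (a : ι → ℤ) (p : ι → κ) (φ : κ → R) (ha : ∀ i, ∑ j ∈ univ.filter fun j => p j = p i, a j = 0) :
    ∑ j, (a j : R) * φ (p j) = 0 := by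
  rw [← Finset.sum_fiberwise_of_maps_to (t := univ.image p)
    (fun j _ => mem_image_of_mem p (mem_univ j))]
  refine sum_eq_zero fun y hy => ?_
  obtain ⟨i, -, rfl⟩ := mem_image.mp hy
  calc ∑ j ∈ univ.filter fun j => p j = p i, (a j : R) * φ (p j)
      = ∑ j ∈ univ.filter fun j => p j = p i, (a j : R) * φ (p i) :=
        sum_congr rfl fun j hj => by rw [(mem_filter.mp hj).2]
    _ = 0 := by rw [← sum_mul, ← Int.cast_sum, ha, Int.cast_zero, zero_mul]

theorem composition_condition_implies_displacement_vanishes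
    (f g : Polynomial ℂ) (m : ℕ) (hm : 1 ≤ m) (hdeg : f.natDegree = m)
    (a : Fin m → ℤ) (hcycle : ∑ i, a i = 0)
    (t₀ : ℂ) (δ r : ℝ) (hδ : 0 < δ) (hr : 0 < r)
    (hreg : ∀ w : ℂ, f.eval w = t₀ → f.derivative.eval w ≠ 0)
    (z : Fin m → ℂ → ℂ → ℂ)
    (hcont : ∀ i, ContinuousOn (fun p : ℂ × ℂ => z i p.1 p.2) (ball t₀ δ ×ˢ ball 0 r))
    (hroot : ∀ i, ∀ t ∈ ball t₀ δ, ∀ ε ∈ ball (0 : ℂ) r,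
      f.eval (z i t ε) + ε * g.eval (z i t ε) = t)
    (hsep : ∀ i j, i ≠ j → ∀ t ∈ ball t₀ δ, ∀ ε ∈ ball (0 : ℂ) r, z i t ε ≠ z j t ε)
    -- the composition condition, with composition factor `h`:
    (ftil gtil h : Polynomial ℂ)
    (hf : f = ftil.comp h) (hg : g = gtil.comp h)
    (htrivial : ∀ t ∈ ball t₀ δ, ∀ ε ∈ ball (0 : ℂ) r, ∀ i,
      ∑ j ∈ univ.filter fun j => h.eval (z j t ε) = h.eval (z i t ε), a j = 0) :
    ∀ t ∈ ball t₀ δ, ∀ ε ∈ ball (0 : ℂ) r,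
      ∑ j, (a j : ℂ) * f.eval (z j t ε) = 0 ∧
      ∑ j, (a j : ℂ) * f.eval (z j t ε) = ∑ j, (a j : ℂ) * ftil.eval (h.eval (z j t ε)) := by
  intro t ht ε hε
  have hcomp : ∑ j, (a j : ℂ) * f.eval (z j t ε) = ∑ j, (a j : ℂ) * ftil.eval (h.eval (z j t ε)) :=
    sum_congr rfl fun j _ => by rw [hf, eval_comp]
  exact ⟨hcomp.trans (sum_intCast_mul_comp_eq_zero a (fun j => h.eval (z j t ε))
    (fun y => ftil.eval y) (htrivial t ht ε hε)), hcomp⟩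
end
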